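/- arXiv:1310.2447 — 2 statements merged into one kernel-verified Lean document; each statement's English description precedes it below -/
import Mathlib

section
/- Let F ∈ ℝ[X,Y] be a bivariate polynomial of total degree d ≥ 1 which is irreducible in ℂ[X,Y] and with ∂F/∂Y not the zero polynomial. Let (α₁,β₁), …, (α_t,β_t) be distinct pairs of natural numbers, and assume that for all reals c₁, …, c_t, if F divides ∑_{j=1}^{t} c_j X^{α_j} Y^{β_j} in ℝ[X,Y] then c₁ = ⋯ = c_t = 0. Then for every s with 1 ≤ s ≤ t there exists a nonzero polynomial T_s ∈ ℝ[X,Y] of degree at most (1+2d)·s(s−1)/2 in each of the two variables, such that for every open interval I ⊆ ℝ and every real analytic function φ : I → ℝ satisfying F(x, φ(x)) = 0 and F_Y(x, φ(x)) ≠ 0 for all x ∈ I, the Wronskian W(x) of the s functions x ↦ x^{α₁}φ(x)^{β₁}, …, x ↦ x^{α_s}φ(x)^{β_s} satisfies, for all x ∈ I: x^{s(s−1)/2} · φ(x)^{s(s−1)/2} · (F_Y(x, φ(x)))^{s(s−1)} · W(x) = x^{α} · φ(x)^{β} · T_s(x, φ(x)), where α = ∑_{j=1}^{s} α_j and β = ∑_{j=1}^{s}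 β_j; moreover this Wronskian W is not identically 0 on I. -/
open MvPolynomial

theorem MvPolynomial.degreeOf_pderiv_le {σ R : Type*} [CommSemiring R] (n i : σ)
    (p : MvPolynomial σ R) : degreeOf n (pderiv i p) ≤ degreeOf n p := by
  rw [degreeOf_le_iff]
  intro m hm
  rw [mem_support_iff, coeff_pderiv] at hm
  have h := degreeOf_le_iff.1 (le_refl (degreeOf n p)) (m + Finsupp.single i 1)
    (mem_support_iff.2 (left_ne_zero_of_mul hm))
  exact le_trans (by simp) h

theorem MvPolynomial.irreducible_of_irreducible_map {σ R S : Type*} [CommRing R] [CommRing S]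
    (f : R →+* S) [IsLocalHom f] (hf : Function.Injective f)
    {p : MvPolynomial σ R} (hp : Irreducible (p.map f)) : Irreducible p := by
  have : IsLocalHom (MvPolynomial.map f : MvPolynomial σ R →+* MvPolynomial σ S) := by
    refine ⟨fun q hq => ?_⟩
    rw [MvPolynomial.isUnit_iff] at hq ⊢
    simp only [coeff_map, IsNilpotent.map_iff hf] at hq
    exact ⟨isUnit_of_map_unit f _ hq.1, hq.2⟩
  exact Irreducible.of_map hp

theorem Polynomial.exists_mul_add_mul_eq_C_of_irreducible {R : Type*} [CommRing R] [IsDomain R]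
    [IsGCDMonoid R] {p q : Polynomial R} (hp : Irreducible p) (hdeg : p.natDegree ≠ 0)
    (hpq : ¬ p ∣ q) : ∃ (a b : Polynomial R) (r : R), r ≠ 0 ∧ a * p + b * q = C r := by
  have hprim : p.IsPrimitive := hp.isPrimitive hdeg
  let K := FractionRing R
  have hirr : Irreducible (p.map (algebraMap R K)) :=
    hprim.irreducible_iff_irreducible_map_fraction_map.1 hp
  have hndvd : ¬ p.map (algebraMap R K) ∣ q.map (algebraMap R K) := fun h =>
    hpq (hprim.dvd_of_fraction_map_dvd_fraction_map h)
  obtain ⟨u, v, huv⟩ := hirr.coprime_iff_not_dvd.2 hndvd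
  obtain ⟨b, hb, hb'⟩ := IsLocalization.integerNormalization_spec (nonZeroDivisors R) u
  obtain ⟨c, hc, hc'⟩ := IsLocalization.integerNormalization_spec (nonZeroDivisors R) v
  refine ⟨C c * IsLocalization.integerNormalization (nonZeroDivisors R) u,
    C b * IsLocalization.integerNormalization (nonZeroDivisors R) v, b * c,
    mul_ne_zero (nonZeroDivisors.ne_zero hb) (nonZeroDivisors.ne_zero hc), ?_⟩
  apply Polynomial.map_injective (algebraMap R K) (IsFractionRing.injective R K)
  simp only [Polynomial.map_add, Polynomial.map_mul, hb', hc', Polynomial.map_C, map_mul]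
  rw [← IsScalarTower.algebraMap_smul K b u, ← IsScalarTower.algebraMap_smul K c v,
    Polynomial.smul_eq_C_mul, Polynomial.smul_eq_C_mul]
  linear_combination (C ((algebraMap R K) b) * C ((algebraMap R K) c)) * huv

theorem MvPolynomial.finite_fst_of_common_zeros {F G : MvPolynomial (Fin 2) ℝ}
    (hF : Irreducible F) (hFY : pderiv (1 : Fin 2) F ≠ 0) (hFG : ¬ F ∣ G) :
    {x : ℝ | ∃ y, eval ![x, y] F = 0 ∧ eval ![x, y] G = 0}.Finite := by
  let e := Polynomial.Bivariate.equivMvPolynomial ℝ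
  obtain ⟨p, rfl⟩ := e.surjective F
  obtain ⟨q, rfl⟩ := e.surjective G
  have hp : Irreducible p := (MulEquiv.irreducible_iff e).1 hF
  have hpq : ¬ p ∣ q := fun h => hFG (map_dvd e h)
  have hdeg : p.natDegree ≠ 0 := by
    intro h
    apply hFY
    rw [Polynomial.Bivariate.pderiv_one_equivMvPolynomial,
      Polynomial.eq_C_of_natDegree_eq_zero h]
    simp
  obtain ⟨a, b, r, hr, hab⟩ :=
    Polynomial.exists_mul_add_mul_eq_C_of_irreducible hp hdeg hpq
  refine (r.rootSet_finite ℝ).subset ?_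
  rintro x ⟨y, h1, h2⟩
  rw [Polynomial.mem_rootSet]
  refine ⟨hr, ?_⟩
  have h := congrArg (fun w => eval ![x, y] (e w)) hab
  simp only [map_add, map_mul, h1, h2, mul_zero, add_zero] at h
  rw [h]
  clear h hab hr
  induction r using Polynomial.induction_on' with
  | add p q hp hq => simp only [map_add, hp, hq]
  | monomial n a => simp [e, ← Polynomial.C_mul_X_pow_eq_monomial]

theorem MvPolynomial.hasDerivAt_eval (p : MvPolynomial (Fin 2) ℝ) {φ : ℝ → ℝ} {φ' x : ℝ}
    (hφ : HasDerivAt φ φ' x) :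
    HasDerivAt (fun y => eval ![y, φ y] p)
      (eval ![x, φ x] (pderiv 0 p) + eval ![x, φ x] (pderiv 1 p) * φ') x := by
  induction p using MvPolynomial.induction_on with
  | C a => simpa using hasDerivAt_const x a
  | add p q hp hq =>
    simp only [map_add]
    exact (hp.add hq).congr_deriv (by ring)
  | mul_X p i hp =>
    simp only [map_mul, pderiv_mul, map_add, eval_X]
    fin_cases i
    · exact (hp.mul (hasDerivAt_id x)).congr_deriv (by simp; ring)
    · exact (hp.mul hφ).congr_deriv (by simp; ring)

theorem Matrix.differentiableAt_det {n : Type*} [Fintype n] [DecidableEq n] {A : ℝ → Matrix n n ℝ}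
    {x : ℝ} (hA : ∀ i j, DifferentiableAt ℝ (fun y => A y i j) x) :
    DifferentiableAt ℝ (fun y => (A y).det) x := by
  simp only [Matrix.det_apply]
  refine DifferentiableAt.fun_sum fun σ _ => ?_
  exact (DifferentiableAt.fun_finsetProd fun i _ => hA _ _).const_smul _

theorem exists_linear_relation_of_wronskian_eq_zero {s : ℕ} (f : ℕ → Fin s → ℝ → ℝ) {I : Set ℝ}
    (hI : IsOpen I) (hne : I.Nonempty)
    (hf : ∀ i j, ∀ x ∈ I, HasDerivAt (f i j) (f (i + 1) j x) x)
    (hW : ∀ x ∈ I, Matrix.det (Matrix.of fun i j : Fin s => f i j x) = 0) :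
    ∃ c : Fin s → ℝ, c ≠ 0 ∧ ∃ J ⊆ I, IsOpen J ∧ J.Nonempty ∧ ∀ x ∈ J, ∑ j, c j * f 0 j x = 0 := by
  induction s with
  | zero =>
    obtain ⟨x, hx⟩ := hne
    simpa using hW x hx
  | succ s ih =>
    let M : ℝ → Matrix (Fin s) (Fin s) ℝ := fun x => Matrix.of fun i j => f i j.castSucc x
    by_cases h : ∀ x ∈ I, (M x).det = 0
    · obtain ⟨c, hc, J, hJI, hJ, hJne, hrel⟩ :=
        ih (fun i j => f i j.castSucc) (fun i j => hf i j.castSucc) h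
      refine ⟨Fin.snoc c 0, fun h0 => hc ?_, J, hJI, hJ, hJne, fun x hx => ?_⟩
      · ext j
        simpa using congrFun h0 j.castSucc
      · simpa [Fin.sum_univ_castSucc] using hrel x hx
    · push Not at h
      obtain ⟨x₀, hx₀, hdet₀⟩ := h
      have hMdiff : ∀ x ∈ I, DifferentiableAt ℝ (fun y => (M y).det) x := fun x hx =>
        Matrix.differentiableAt_det fun i j => (hf i j.castSucc x hx).differentiableAt
      obtain ⟨ε, hε, hball⟩ := Metric.mem_nhds_iff.1 (Filter.inter_mem (hI.mem_nhds hx₀)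
        ((hMdiff x₀ hx₀).continuousAt.eventually_ne hdet₀))
      set J := Metric.ball x₀ ε with hJdef
      have hJI : J ⊆ I := fun x hx => (hball hx).1
      have hdet : ∀ x ∈ J, (M x).det ≠ 0 := fun x hx => (hball hx).2
      let v : ℝ → Fin s → ℝ := fun x i => f i (Fin.last s) x
      let g : Fin s → ℝ → ℝ := fun j x => -(((M x).updateCol j (v x)).det / (M x).det)
      have hgdiff : ∀ j, ∀ x ∈ J, DifferentiableAt ℝ (g j) x := by
        intro j x hx
        refine ((Matrix.differentiableAt_det fun i k => ?_).div (hMdiff x (hJI hx)) (hdet x hx)).neg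
        by_cases hk : k = j
        · subst hk
          simpa [v] using (hf i _ x (hJI hx)).differentiableAt
        · simpa [hk, M] using (hf i _ x (hJI hx)).differentiableAt
      have hzero : ∀ x ∈ J, ∀ w : Fin s → ℝ, (∀ i : Fin s, ∑ j, f i j.castSucc x * w j = 0) →
          w = 0 := fun x hx w hw =>
        Matrix.eq_zero_of_mulVec_eq_zero (hdet x hx) (funext fun i => hw i)
      have hrow : ∀ x ∈ J, ∀ i : Fin s,
          ∑ j, f i j.castSucc x * g j x + f i (Fin.last s) x = 0 := by
        intro x hx i
        have h := congrFun (Matrix.mulVec_cramer (M x) (v x)) i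
        simp only [Matrix.mulVec, dotProduct, Matrix.cramer_apply, Pi.smul_apply,
          smul_eq_mul] at h
        have h2 : ∑ j, f i j.castSucc x * g j x =
            -(∑ j, M x i j * ((M x).updateCol j (v x)).det) / (M x).det := by
          rw [neg_div, Finset.sum_div, ← Finset.sum_neg_distrib]
          refine Finset.sum_congr rfl fun j _ => ?_
          simp only [g, M, Matrix.of_apply]
          ring
        rw [h2, h]
        have := hdet x hx
        field_simp
        simp [v]
      have hlast : ∀ x ∈ J, ∑ j, f s j.castSucc x * g j x + f s (Fin.last s) x = 0 := by
        intro x hx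
        obtain ⟨w, hw, hNw⟩ := Matrix.exists_mulVec_eq_zero_iff.2 (hW x (hJI hx))
        have hNw' : ∀ i : Fin (s + 1), ∑ j : Fin s, f i j.castSucc x * w j.castSucc +
            f i (Fin.last s) x * w (Fin.last s) = 0 := by
          intro i
          simpa [Matrix.mulVec, dotProduct, Fin.sum_univ_castSucc] using congrFun hNw i
        have hwg : ∀ j : Fin s, w j.castSucc = w (Fin.last s) * g j x := by
          intro j
          have := hzero x hx (fun j => w j.castSucc - w (Fin.last s) * g j x) fun i => by
            have h1 := hNw' i.castSucc
            have h2 := hrow x hx i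
            simp only [mul_sub, Finset.sum_sub_distrib, mul_left_comm _ (w (Fin.last s)),
              ← Finset.mul_sum]
            simp only [Fin.val_castSucc] at h1
            linear_combination h1 - w (Fin.last s) * h2
          exact sub_eq_zero.1 (congrFun this j)
        have hwl : w (Fin.last s) ≠ 0 := by
          intro h0
          apply hw
          ext j
          refine Fin.lastCases h0 (fun j => ?_) j
          simp [hwg, h0]
        have h := hNw' (Fin.last s)
        simp only [hwg, mul_left_comm _ (w (Fin.last s)), ← Finset.mul_sum, Fin.val_last] at h
        refine (mul_eq_zero.1 ?_).resolve_left hwl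
        linear_combination h
      have hrow' : ∀ x ∈ J, ∀ i : ℕ, i ≤ s →
          ∑ j, f i j.castSucc x * g j x + f i (Fin.last s) x = 0 := by
        intro x hx i hi
        rcases hi.lt_or_eq with hi | rfl
        · exact hrow x hx ⟨i, hi⟩
        · exact hlast x hx
      have hderiv : ∀ x ∈ J, ∀ j, deriv (g j) x = 0 := by
        intro x hx j
        refine congrFun (hzero x hx (fun j => deriv (g j) x) fun i => ?_) j
        have h1 : HasDerivAt (fun y => ∑ j, f i j.castSucc y * g j y + f i (Fin.last s) y)
            (∑ j, (f (i + 1) j.castSucc x * g j x + f i j.castSucc x * deriv (g j) x) +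
              f (i + 1) (Fin.last s) x) x :=
          (HasDerivAt.fun_sum fun j _ => (hf i _ x (hJI hx)).mul (hgdiff j x hx).hasDerivAt).add
            (hf i _ x (hJI hx))
        have h2 : HasDerivAt (fun y => ∑ j, f i j.castSucc y * g j y + f i (Fin.last s) y) 0 x :=
          (hasDerivAt_const x (0 : ℝ)).congr_of_eventuallyEq
            (Filter.eventually_of_mem (Metric.isOpen_ball.mem_nhds hx) fun y hy => hrow y hy i)
        have h3 := h1.unique h2
        rw [Finset.sum_add_distrib] at h3
        linear_combination h3 - hrow' x hx (i + 1) i.2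
      have hconst : ∀ x ∈ J, ∀ j, g j x = g j x₀ := by
        intro x hx j
        exact Metric.isOpen_ball.is_const_of_deriv_eq_zero
          (convex_ball x₀ ε).isPreconnected
          (fun y hy => (hgdiff j y hy).differentiableWithinAt) (fun y hy => hderiv y hy j) hx
          (Metric.mem_ball_self hε)
      refine ⟨Fin.snoc (fun j => g j x₀) 1, fun h0 => ?_, J, hJI, Metric.isOpen_ball,
        ⟨x₀, Metric.mem_ball_self hε⟩, fun x hx => ?_⟩
      · simpa using congrFun h0 (Fin.last s)
      · rw [Fin.sum_univ_castSucc]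
        simp only [Fin.snoc_castSucc, Fin.snoc_last]
        rw [← hrow' x hx 0 (Nat.zero_le _)]
        simp [hconst x hx, mul_comm]

/-- The derivation `G ↦ G_X F_Y - G_Y F_X`: along a branch of the curve `F = 0` it is `F_Y` times
the derivative with respect to the abscissa. -/
noncomputable def curveDerivation (F G : MvPolynomial (Fin 2) ℝ) : MvPolynomial (Fin 2) ℝ :=
  pderiv 0 G * pderiv 1 F - pderiv 1 G * pderiv 0 F

/-- The polynomials `P_i` for which `(X Y F_Y²)^i (X^a Y^b)^{(i)} = X^a Y^b P_i` along every branch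
of the curve `F = 0`. -/
noncomputable def monomialDerivNumerator (F : MvPolynomial (Fin 2) ℝ) (a b : ℕ) :
    ℕ → MvPolynomial (Fin 2) ℝ
  | 0 => 1
  | i + 1 =>
    pderiv 1 F * ((C (a : ℝ) * (X 1 * pderiv 1 F) - C (b : ℝ) * (X 0 * pderiv 0 F)) *
        monomialDerivNumerator F a b i +
      X 0 * X 1 * curveDerivation F (monomialDerivNumerator F a b i)) -
    C (i : ℝ) * (pderiv 1 F * (X 1 * pderiv 1 F - X 0 * pderiv 0 F) +
      C 2 * (X 0 * X 1 * curveDerivation F (pderiv 1 F))) * monomialDerivNumerator F a b i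

theorem degreeOf_curveDerivation_le (n : Fin 2) (F G : MvPolynomial (Fin 2) ℝ) :
    degreeOf n (curveDerivation F G) ≤ degreeOf n G + degreeOf n F :=
  (degreeOf_sub_le _ _ _).trans <| max_le
    ((degreeOf_mul_le _ _ _).trans
      (add_le_add (degreeOf_pderiv_le _ _ _) (degreeOf_pderiv_le _ _ _)))
    ((degreeOf_mul_le _ _ _).trans
      (add_le_add (degreeOf_pderiv_le _ _ _) (degreeOf_pderiv_le _ _ _)))

theorem degreeOf_monomialDerivNumerator_le (n : Fin 2) (F : MvPolynomial (Fin 2) ℝ) (a b i : ℕ) :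
    degreeOf n (monomialDerivNumerator F a b i) ≤ (1 + 2 * degreeOf n F) * i := by
  have hC : ∀ c : ℝ, degreeOf n (C c : MvPolynomial (Fin 2) ℝ) ≤ 0 := fun c => (degreeOf_C c n).le
  have hX : ∀ k : Fin 2, degreeOf n (X k : MvPolynomial (Fin 2) ℝ) ≤ 1 := fun k => by
    rw [degreeOf_X]; split_ifs <;> simp
  have hXX : degreeOf n (X 0 * X 1 : MvPolynomial (Fin 2) ℝ) ≤ 1 := by
    refine (degreeOf_mul_le _ _ _).trans ?_
    fin_cases n <;> simp [degreeOf_X]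
  have hmul : ∀ {p q : MvPolynomial (Fin 2) ℝ} {k l m : ℕ}, degreeOf n p ≤ k →
      degreeOf n q ≤ l → k + l ≤ m → degreeOf n (p * q) ≤ m := fun hp hq h =>
    (degreeOf_mul_le _ _ _).trans ((add_le_add hp hq).trans h)
  have hadd : ∀ {p q : MvPolynomial (Fin 2) ℝ} {k : ℕ}, degreeOf n p ≤ k →
      degreeOf n q ≤ k → degreeOf n (p + q) ≤ k := fun hp hq =>
    (degreeOf_add_le _ _ _).trans (max_le hp hq)
  have hsub : ∀ {p q : MvPolynomial (Fin 2) ℝ} {k : ℕ}, degreeOf n p ≤ k →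
      degreeOf n q ≤ k → degreeOf n (p - q) ≤ k := fun hp hq =>
    (degreeOf_sub_le _ _ _).trans (max_le hp hq)
  have hD := degreeOf_curveDerivation_le n F
  have hF : ∀ k, degreeOf n (pderiv k F) ≤ degreeOf n F := fun k => degreeOf_pderiv_le n k F
  set d := degreeOf n F
  have hXF : ∀ k, degreeOf n (X k * pderiv k F) ≤ 1 + d := fun k => hmul (hX k) (hF k) le_rfl
  induction i with
  | zero => simp [monomialDerivNumerator]
  | succ i ih =>
    rw [monomialDerivNumerator]
    refine hsub (hmul (hF 1) (hadd (k := (1 + d) + (1 + 2 * d) * i) (hmul (hsub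
        (hmul (hC _) (hXF 1) (zero_add _).le) (hmul (hC _) (hXF 0) (zero_add _).le)) ih le_rfl)
        (hmul hXX ((hD _).trans (add_le_add_left ih d)) ?_)) ?_)
      (hmul (hmul (hC _) (hadd (k := 1 + 2 * d) (hmul (hF 1) (hsub (hXF 1) (hXF 0)) ?_)
        (hmul (hC _) (hmul hXX ((hD _).trans (add_le_add_left (hF 1) d)) le_rfl) ?_)) le_rfl)
        ih ?_)
    all_goals lia

theorem eval_monomialDerivNumerator {F : MvPolynomial (Fin 2) ℝ} {a b : ℕ} {I : Set ℝ}
    (hI : IsOpen I) {φ : ℝ → ℝ} (hφ : ∀ x ∈ I, DifferentiableAt ℝ φ x)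
    (hF : ∀ x ∈ I, eval ![x, φ x] F = 0) {f : ℕ → ℝ → ℝ}
    (hf : ∀ i, ∀ x ∈ I, HasDerivAt (f i) (f (i + 1) x) x)
    (hf0 : ∀ x ∈ I, f 0 x = x ^ a * φ x ^ b) (i : ℕ) :
    ∀ x ∈ I, (x * φ x * eval ![x, φ x] (pderiv 1 F) ^ 2) ^ i * f i x =
      x ^ a * φ x ^ b * eval ![x, φ x] (monomialDerivNumerator F a b i) := by
  induction i with
  | zero => simpa [monomialDerivNumerator] using hf0
  | succ i ih =>
    intro x hx
    have hφx := (hφ x hx).hasDerivAt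
    set q := deriv φ x
    have hFx : eval ![x, φ x] (pderiv 0 F) + eval ![x, φ x] (pderiv 1 F) * q = 0 :=
      (hasDerivAt_eval F hφx).unique ((hasDerivAt_const x (0 : ℝ)).congr_of_eventuallyEq
        (Filter.eventually_of_mem (hI.mem_nhds hx) hF))
    have hE := ((hasDerivAt_id x).mul hφx).mul ((hasDerivAt_eval (pderiv 1 F) hφx).pow 2)
    have hL := (hE.pow i).mul (hf i x hx)
    have hR := (((hasDerivAt_id x).pow a).mul (hφx.pow b)).mul
      (hasDerivAt_eval (monomialDerivNumerator F a b i) hφx)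
    have h := hL.unique (hR.congr_of_eventuallyEq
      (Filter.eventually_of_mem (hI.mem_nhds hx) ih))
    have ha : (a : ℝ) * x ^ (a - 1) * x = a * x ^ a := by
      cases a <;> simp [pow_succ, mul_assoc]
    have hb : (b : ℝ) * φ x ^ (b - 1) * φ x = b * φ x ^ b := by
      cases b <;> simp [pow_succ, mul_assoc]
    have hi : ∀ e : ℝ, (i : ℝ) * e ^ (i - 1) * e = i * e ^ i := by
      intro e; cases i <;> simp [pow_succ, mul_assoc]
    have hi := hi (x * φ x * eval ![x, φ x] (pderiv 1 F) ^ 2)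
    have ihx := ih x hx
    simp only [monomialDerivNumerator, curveDerivation, map_add, map_sub, map_mul, eval_X, eval_C,
      Matrix.cons_val_zero, Matrix.cons_val_one, Pi.mul_apply, Pi.pow_apply, id_eq,
      Nat.add_one_sub_one, Nat.cast_ofNat, pow_one] at h ihx ⊢
    generalize eval ![x, φ x] (monomialDerivNumerator F a b i) = p at *
    generalize eval ![x, φ x] (pderiv 0 (monomialDerivNumerator F a b i)) = p₀ at *
    generalize eval ![x, φ x] (pderiv 1 (monomialDerivNumerator F a b i)) = p₁ at *
    generalize eval ![x, φ x] (pderiv 0 (pderiv 1 F)) = w₀ at *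
    generalize eval ![x, φ x] (pderiv 1 (pderiv 1 F)) = w₁ at *
    generalize eval ![x, φ x] (pderiv 0 F) = v at *
    generalize eval ![x, φ x] (pderiv 1 F) = u at *
    generalize φ x = y at *
    linear_combination (x * y * u ^ 2) * h -
      ((y + x * q) * u ^ 2 + x * y * (2 * u * (w₀ + w₁ * q))) * f i x * hi -
      i * ((y + x * q) * u ^ 2 + x * y * (2 * u * (w₀ + w₁ * q))) * ihx +
      y * y ^ b * u ^ 2 * p * ha + x * x ^ a * q * u ^ 2 * p * hb -
      x ^ a * y ^ b * (u * (-b * x * p - x * y * p₁) - i * (-u * x - 2 * x * y * w₁) * p) * hFx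

theorem hasDerivAt_iteratedDerivWithin_of_isOpen {f : ℝ → ℝ} {I : Set ℝ} (hI : IsOpen I)
    (hf : AnalyticOnNhd ℝ f I) (n : ℕ) {x : ℝ} (hx : x ∈ I) :
    HasDerivAt (iteratedDerivWithin n f I) (iteratedDerivWithin (n + 1) f I x) x := by
  have hd := ((hf.contDiffOn hI.uniqueDiffOn (n := ⊤)).differentiableOn_iteratedDerivWithin
    (m := n) (WithTop.coe_lt_top _) hI.uniqueDiffOn).differentiableAt (hI.mem_nhds hx)
  rw [iteratedDerivWithin_succ, derivWithin_of_isOpen hI hx]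
  exact hd.hasDerivAt

theorem MvPolynomial.degreeOf_det_le {σ R : Type*} [CommRing R] {s : ℕ} (n : σ)
    (A : Matrix (Fin s) (Fin s) (MvPolynomial σ R)) (k : ℕ)
    (hA : ∀ i j, degreeOf n (A i j) ≤ k * i) : degreeOf n A.det ≤ k * (s * (s - 1) / 2) := by
  have hsum : ∑ i : Fin s, k * (i : ℕ) = k * (s * (s - 1) / 2) := by
    rw [← Finset.mul_sum, Fin.sum_univ_eq_sum_range (fun i => i), Finset.sum_range_id]
  rw [← Matrix.det_transpose, Matrix.det_apply']
  refine (degreeOf_sum_le _ _ _).trans (Finset.sup_le fun σ _ => ?_)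
  refine (degreeOf_mul_le _ _ _).trans ?_
  rw [← map_intCast (C : R →+* MvPolynomial _ R), degreeOf_C, zero_add, ← hsum]
  exact (degreeOf_prod_le _ _ _).trans (Finset.sum_le_sum fun i _ => hA _ _)

/-- The determinant of the polynomials `monomialDerivNumerator`, which represents the Wronskian of
the monomials with exponents `e` along the branches of the curve `F = 0`. -/
noncomputable def monomialWronskianNumerator (F : MvPolynomial (Fin 2) ℝ) {s : ℕ}
    (e : Fin s → ℕ × ℕ) : MvPolynomial (Fin 2) ℝ :=
  Matrix.det (Matrix.of fun i j : Fin s => monomialDerivNumerator F (e j).1 (e j).2 i)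

theorem eval_monomialWronskianNumerator {F : MvPolynomial (Fin 2) ℝ} {s : ℕ} (e : Fin s → ℕ × ℕ)
    {I : Set ℝ} (hI : IsOpen I) {φ : ℝ → ℝ} (hφ : AnalyticOnNhd ℝ φ I)
    (hF : ∀ x ∈ I, eval ![x, φ x] F = 0) {x : ℝ} (hx : x ∈ I) :
    x ^ (s * (s - 1) / 2) * φ x ^ (s * (s - 1) / 2) *
        (eval ![x, φ x] (pderiv (1 : Fin 2) F)) ^ (s * (s - 1)) *
        Matrix.det (Matrix.of fun i j : Fin s =>
          iteratedDerivWithin i (fun y => y ^ (e j).1 * φ y ^ (e j).2) I x) =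
      x ^ (∑ j : Fin s, (e j).1) * φ x ^ (∑ j : Fin s, (e j).2) *
        eval ![x, φ x] (monomialWronskianNumerator F e) := by
  have hsum : ∑ i : Fin s, (i : ℕ) = s * (s - 1) / 2 := by
    rw [Fin.sum_univ_eq_sum_range (fun i => i), Finset.sum_range_id]
  have hentry : ∀ i j : Fin s,
      (x * φ x * eval ![x, φ x] (pderiv 1 F) ^ 2) ^ (i : ℕ) *
          iteratedDerivWithin i (fun y => y ^ (e j).1 * φ y ^ (e j).2) I x =
        (x ^ (e j).1 * φ x ^ (e j).2) *
          eval ![x, φ x] (monomialDerivNumerator F (e j).1 (e j).2 i) := fun i j =>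
    eval_monomialDerivNumerator hI (fun y hy => (hφ y hy).differentiableAt) hF
      (f := fun i => iteratedDerivWithin i (fun y => y ^ (e j).1 * φ y ^ (e j).2) I)
      (fun i y hy => hasDerivAt_iteratedDerivWithin_of_isOpen hI
        ((analyticOnNhd_id.pow _).mul (hφ.pow _)) i hy)
      (fun y _ => by simp) i x hx
  have h := (Matrix.det_mul_column
      (fun i : Fin s => (x * φ x * eval ![x, φ x] (pderiv 1 F) ^ 2) ^ (i : ℕ))
      (Matrix.of fun i j : Fin s =>
        iteratedDerivWithin i (fun y => y ^ (e j).1 * φ y ^ (e j).2) I x)).symm.trans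
    ((congrArg Matrix.det (Matrix.ext hentry)).trans
      (Matrix.det_mul_row (fun j : Fin s => x ^ (e j).1 * φ x ^ (e j).2)
        (Matrix.of fun i j : Fin s =>
          eval ![x, φ x] (monomialDerivNumerator F (e j).1 (e j).2 i))))
  rw [Finset.prod_pow_eq_pow_sum, hsum, mul_pow, mul_pow, ← pow_mul,
    Nat.mul_div_cancel' (Nat.even_mul_pred_self s).two_dvd, Finset.prod_mul_distrib,
    Finset.prod_pow_eq_pow_sum, Finset.prod_pow_eq_pow_sum] at h
  rw [h, monomialWronskianNumerator, RingHom.map_det]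
  rfl

theorem wronskian_monomials_ne_zero {F : MvPolynomial (Fin 2) ℝ} (hirr : Irreducible F)
    (hFY : pderiv (1 : Fin 2) F ≠ 0) {s : ℕ} (e : Fin s → ℕ × ℕ)
    (hnomul : ∀ c : Fin s → ℝ,
      F ∣ (∑ j : Fin s, C (c j) * X 0 ^ (e j).1 * X 1 ^ (e j).2) → ∀ j, c j = 0)
    {I : Set ℝ} (hI : IsOpen I) (hne : I.Nonempty) {φ : ℝ → ℝ} (hφ : AnalyticOnNhd ℝ φ I)
    (hF : ∀ x ∈ I, eval ![x, φ x] F = 0) :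
    ¬ ∀ x ∈ I, Matrix.det (Matrix.of fun i j : Fin s =>
      iteratedDerivWithin i (fun y => y ^ (e j).1 * φ y ^ (e j).2) I x) = 0 := by
  intro hW
  obtain ⟨c, hc, J, hJI, hJ, ⟨x₀, hx₀⟩, hrel⟩ := exists_linear_relation_of_wronskian_eq_zero
    (fun i j => iteratedDerivWithin i (fun y => y ^ (e j).1 * φ y ^ (e j).2) I) hI hne
    (fun i j x hx => hasDerivAt_iteratedDerivWithin_of_isOpen hI
      ((analyticOnNhd_id.pow _).mul (hφ.pow _)) i hx) hW
  refine hc (funext (hnomul c ?_))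
  by_contra hndvd
  refine (infinite_of_mem_nhds x₀ (hJ.mem_nhds hx₀)).mono (fun x hx => ?_)
    (finite_fst_of_common_zeros hirr hFY hndvd)
  refine ⟨φ x, hF x (hJI hx), ?_⟩
  rw [← hrel x hx]
  simp [mul_assoc]



/-- **Lemma 9 (the key Wronskian computation).**
Let `F ∈ ℝ[X,Y]` have total degree `d ≥ 1`, be irreducible in `ℂ[X,Y]`, with
`F_Y = ∂F/∂Y ≠ 0`.  Let `(α j, β j)` (`j < t`) be distinct pairs of exponents such that
no nontrivial linear combination `∑ c_j X^{α_j} Y^{β_j}` is a multiple of `F`.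
Then for each `1 ≤ s ≤ t` there is a nonzero `T_s ∈ ℝ[X,Y]`, of degree at most
`(1+2d)·(s choose 2)` in each variable, such that for every nonempty open interval `I`
and every analytic `φ : I → ℝ` with `F(x, φ(x)) = 0` and `F_Y(x, φ(x)) ≠ 0` on `I`,
the Wronskian `W` of the functions `x ↦ x^{α_j} φ(x)^{β_j}` (`j < s`) satisfies
`x^(s(s-1)/2) φ(x)^(s(s-1)/2) F_Y(x,φ(x))^(s(s-1)) W(x) = x^α φ(x)^β T_s(x, φ(x))`
on `I`, where `α = ∑_{j<s} α_j`, `β = ∑_{j<s} β_j`; moreover `W` is not identically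
zero on `I`. -/
theorem wronskian_eq_sparse_poly_of_implicit
    (F : MvPolynomial (Fin 2) ℝ) (d : ℕ) (hd : F.totalDegree = d) (hd1 : 1 ≤ d)
    (hirr : Irreducible (F.map (algebraMap ℝ ℂ)))
    (hFY : pderiv (1 : Fin 2) F ≠ 0)
    (t : ℕ) (ab : Fin t → ℕ × ℕ) (hab : Function.Injective ab)
    (hnomul : ∀ c : Fin t → ℝ,
      F ∣ (∑ j : Fin t, C (c j) * X 0 ^ (ab j).1 * X 1 ^ (ab j).2) → ∀ j, c j = 0) :
    ∀ s : ℕ, 1 ≤ s → ∀ hs : s ≤ t,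
      ∃ T : MvPolynomial (Fin 2) ℝ, T ≠ 0 ∧
        degreeOf 0 T ≤ (1 + 2 * d) * (s * (s - 1) / 2) ∧
        degreeOf 1 T ≤ (1 + 2 * d) * (s * (s - 1) / 2) ∧
        ∀ (I : Set ℝ), IsOpen I → I.Nonempty →
          ∀ φ : ℝ → ℝ, AnalyticOnNhd ℝ φ I →
            (∀ x ∈ I, eval ![x, φ x] F = 0) →
            (∀ x ∈ I, eval ![x, φ x] (pderiv (1 : Fin 2) F) ≠ 0) →
            ∀ W : ℝ → ℝ,
              (W = fun x => Matrix.det (Matrix.of fun i j : Fin s =>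
                iteratedDerivWithin i
                  (fun y => y ^ (ab (Fin.castLE hs j)).1 * φ y ^ (ab (Fin.castLE hs j)).2)
                  I x)) →
              (∀ x ∈ I,
                  x ^ (s * (s - 1) / 2) * φ x ^ (s * (s - 1) / 2) *
                      (eval ![x, φ x] (pderiv (1 : Fin 2) F)) ^ (s * (s - 1)) * W x =
                    x ^ (∑ j : Fin s, (ab (Fin.castLE hs j)).1) *
                      φ x ^ (∑ j : Fin s, (ab (Fin.castLE hs j)).2) *
                      eval ![x, φ x] T) ∧
                ¬ ∀ x ∈ I, W x = 0 := by
  intro s hs1 hs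
  have hirrF : Irreducible F :=
    irreducible_of_irreducible_map (algebraMap ℝ ℂ) (algebraMap ℝ ℂ).injective hirr
  have hndvd : ∀ c : Fin s → ℝ, F ∣ (∑ j : Fin s, C (c j) * X 0 ^ (ab (Fin.castLE hs j)).1 *
      X 1 ^ (ab (Fin.castLE hs j)).2) → ∀ j, c j = 0 := by
    intro c hc j
    have hinj := Fin.castLE_injective hs
    have h := hnomul (Function.extend (Fin.castLE hs) c 0) ?_ (Fin.castLE hs j)
    · rwa [hinj.extend_apply] at h
    · convert hc using 1
      symm
      refine Finset.sum_of_injOn (Fin.castLE hs) hinj.injOn (by simp) ?_ ?_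
      · intro i _ hi
        rw [Function.extend_apply' _ _ _ (fun ⟨k, hk⟩ => hi ⟨k, by simp, hk⟩)]
        simp
      · intro i _
        rw [hinj.extend_apply]
  have hdegF : ∀ n, degreeOf n F ≤ d := fun n => hd ▸ degreeOf_le_totalDegree F n
  set e : Fin s → ℕ × ℕ := fun j => ab (Fin.castLE hs j) with he
  have hdegT : ∀ n, degreeOf n (monomialWronskianNumerator F e) ≤
      (1 + 2 * d) * (s * (s - 1) / 2) := fun n =>
    degreeOf_det_le n _ _ fun i j => (degreeOf_monomialDerivNumerator_le n F _ _ i).trans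
      (Nat.mul_le_mul_right _ (by have := hdegF n; lia))
  by_cases hT : monomialWronskianNumerator F e = 0
  · have hs2 : 2 ≤ s := by
      by_contra hlt
      obtain rfl : s = 1 := by lia
      simp [monomialWronskianNumerator, monomialDerivNumerator] at hT
    have hdegF' : ∀ n, degreeOf n F ≤ (1 + 2 * d) * (s * (s - 1) / 2) := by
      intro n
      have h1 : 1 ≤ s * (s - 1) / 2 := by
        rw [Nat.one_le_div_iff two_pos]
        exact Nat.mul_le_mul hs2 (by lia : 1 ≤ s - 1)
      have := hdegF n
      nlinarith
    refine ⟨F, hirrF.ne_zero, hdegF' 0, hdegF' 1, ?_⟩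
    rintro I hI hne φ hφ hF - W rfl
    refine ⟨fun x hx => ?_, wronskian_monomials_ne_zero hirrF hFY e hndvd hI hne hφ hF⟩
    rw [eval_monomialWronskianNumerator e hI hφ hF hx, hT, hF x hx, map_zero]
  · refine ⟨monomialWronskianNumerator F e, hT, hdegT 0, hdegT 1, ?_⟩
    rintro I hI hne φ hφ hF - W rfl
    exact ⟨fun x hx => eval_monomialWronskianNumerator e hI hφ hF hx,
      wronskian_monomials_ne_zero hirrF hFY e hndvd hI hne hφ hF⟩
end

section
/- Let V ⊆ ℝⁿ be defined by a system of polynomial equations f₁ = 0, …, f_p = 0, where f₁, …, f_p are real polynomials in n variables of degree at most d, with d ≥ 1. Then the number of connected components of V is at most d·(2d−1)^{n−1}. -/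
open MvPolynomial

theorem LinearMap.finite_setOf_not_surjective_add_smul {K V : Type*} [Field K] [AddCommGroup V]
    [Module K V] [FiniteDimensional K V] (A H : V →ₗ[K] V) (hA : Function.Surjective A) :
    {s : K | ¬ Function.Surjective (A + s • H)}.Finite := by
  have hinj : Function.Injective A := LinearMap.injective_iff_surjective.2 hA
  let e := LinearEquiv.ofBijective A ⟨hinj, hA⟩
  let T : Module.End K V := e.symm.toLinearMap ∘ₗ H
  refine Set.Finite.subset (T.finite_hasEigenvalue.preimage (f := fun s : K => -s⁻¹) ?_) ?_
  · intro a _ b _ h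
    simpa using h
  · intro s hs
    rw [Set.mem_ofPred_eq, ← LinearMap.injective_iff_surjective, injective_iff_map_eq_zero] at hs
    push Not at hs
    obtain ⟨v, hv, hv0⟩ := hs
    have h1 : A v + s • H v = 0 := by simpa using hv
    have hs0 : s ≠ 0 := by
      rintro rfl
      exact hv0 (hinj (by simpa using h1))
    have h2 : v + s • e.symm (H v) = 0 := by
      have h3 := congrArg e.symm h1
      have h4 : e.symm (A v) = v := e.symm_apply_apply v
      rw [map_add, map_smul, map_zero, h4] at h3
      exact h3
    have h3 : T v = (-s⁻¹) • v := by
      have : v = -(s • e.symm (H v)) := eq_neg_of_add_eq_zero_left h2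
      change e.symm (H v) = _
      conv_rhs => rw [this]
      simp [smul_smul, hs0]
    exact Module.End.hasEigenvalue_of_hasEigenvector
      (Module.End.hasEigenvector_iff.2 ⟨Module.End.mem_eigenspace_iff.2 h3, hv0⟩)

namespace MvPolynomial

variable {σ K : Type*} [Field K]

theorem mem_restrictSupport_degree_lt_of_totalDegree_lt {p : MvPolynomial σ K} {k : ℕ}
    (h : p.totalDegree < k) : p ∈ restrictSupport K {m : σ →₀ ℕ | m.degree < k} := by
  rw [mem_restrictSupport_iff]
  intro m hm
  exact lt_of_le_of_lt (le_totalDegree hm) h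

open Classical in
/-- Replace each monomial `m` divisible by some `X i ^ e i` by `m / X i ^ e i * g i`,
and send the other monomials to zero. -/
noncomputable def reduceLeading (e : σ → ℕ) (g : σ → MvPolynomial σ K) :
    MvPolynomial σ K →ₗ[K] MvPolynomial σ K :=
  (basisMonomials σ K).constr K fun m =>
    if h : ∃ i, e i ≤ m i then
      monomial (m - Finsupp.single h.choose (e h.choose)) 1 * g h.choose
    else 0

theorem reduceLeading_monomial_of_exists {e : σ → ℕ} {m : σ →₀ ℕ} (h : ∃ i, e i ≤ m i) :
    ∃ i, e i ≤ m i ∧ ∀ g : σ → MvPolynomial σ K,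
      reduceLeading e g (monomial m 1) = monomial (m - Finsupp.single i (e i)) 1 * g i := by
  classical
  refine ⟨h.choose, h.choose_spec, fun g => ?_⟩
  have := (basisMonomials σ K).constr_basis K (fun m =>
    if h : ∃ i, e i ≤ m i then
      monomial (m - Finsupp.single h.choose (e h.choose)) 1 * g h.choose
    else 0) m
  rw [coe_basisMonomials] at this
  rw [reduceLeading]
  convert! this using 1
  rw [dif_pos h]

theorem reduceLeading_monomial_of_not_exists {e : σ → ℕ} {m : σ →₀ ℕ} (h : ¬ ∃ i, e i ≤ m i)
    (g : σ → MvPolynomial σ K) : reduceLeading e g (monomial m 1) = 0 := by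
  classical
  have := (basisMonomials σ K).constr_basis K (fun m =>
    if h : ∃ i, e i ≤ m i then
      monomial (m - Finsupp.single h.choose (e h.choose)) 1 * g h.choose
    else 0) m
  rw [coe_basisMonomials] at this
  rw [reduceLeading]
  convert! this using 1
  rw [dif_neg h]

theorem reduceLeading_mem_restrictSupport {e : σ → ℕ} {g : σ → MvPolynomial σ K} {r k : ℕ}
    (hg : ∀ i, (g i).totalDegree + r ≤ e i) {p : MvPolynomial σ K}
    (hp : p ∈ restrictSupport K {m : σ →₀ ℕ | m.degree < k + r}) :
    reduceLeading e g p ∈ restrictSupport K {m : σ →₀ ℕ | m.degree < k} := by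
  rw [restrictSupport_eq_span] at hp
  induction hp using Submodule.span_induction with
  | zero => simp
  | add x y _ _ hx hy => rw [map_add]; exact add_mem hx hy
  | smul a x _ hx => rw [map_smul]; exact Submodule.smul_mem _ _ hx
  | mem x hx =>
    obtain ⟨m, hm, rfl⟩ := hx
    by_cases h : ∃ i, e i ≤ m i
    · obtain ⟨i, hi, hL⟩ := reduceLeading_monomial_of_exists (K := K) h
      change reduceLeading e g (monomial m 1) ∈ _
      rw [hL]
      apply mem_restrictSupport_degree_lt_of_totalDegree_lt
      have h1 : m = (m - Finsupp.single i (e i)) + Finsupp.single i (e i) := by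
        rw [tsub_add_cancel_of_le]
        simpa using hi
      have h2 : m.degree = (m - Finsupp.single i (e i)).degree + e i := by
        conv_lhs => rw [h1]
        simp
      have h3 := totalDegree_mul (monomial (m - Finsupp.single i (e i)) (1 : K)) (g i)
      have h4 : (monomial (m - Finsupp.single i (e i)) (1 : K)).totalDegree
          ≤ (m - Finsupp.single i (e i)).degree := totalDegree_monomial_le _ _
      have h5 : m.degree < k + r := hm
      have := hg i
      omega
    · change reduceLeading e g (monomial m 1) ∈ _
      rw [reduceLeading_monomial_of_not_exists h]
      exact zero_mem _

theorem exists_add_reduceLeading_eq {e : σ → ℕ} {g : σ → MvPolynomial σ K}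
    (hg : ∀ i, (g i).totalDegree < e i) (k : ℕ) {p : MvPolynomial σ K}
    (hp : p ∈ restrictSupport K {m : σ →₀ ℕ | m.degree < k}) :
    ∃ q ∈ restrictSupport K {m : σ →₀ ℕ | m.degree < k}, q + reduceLeading e g q = p := by
  induction k generalizing p with
  | zero =>
    refine ⟨0, zero_mem _, ?_⟩
    rw [mem_restrictSupport_iff] at hp
    have : p = 0 := by
      rw [← support_eq_empty]
      refine Finset.eq_empty_of_forall_notMem fun m hm => ?_
      exact Nat.not_lt_zero _ (hp hm)
    simp [this]
  | succ k ih =>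
    obtain ⟨q, hq, h⟩ := ih (reduceLeading_mem_restrictSupport (r := 1) hg hp)
    refine ⟨p - q, sub_mem hp (restrictSupport_mono K (fun m hm => ?_) hq), ?_⟩
    · exact Nat.lt_succ_of_lt hm
    · rw [map_sub, ← h]; abel

instance finiteDimensional_restrictSupport_degree_lt [Finite σ] (k : ℕ) :
    FiniteDimensional K (restrictSupport K {m : σ →₀ ℕ | m.degree < k}) :=
  Submodule.finiteDimensional_of_le (S₂ := restrictTotalDegree σ K k)
    (restrictSupport_mono K fun m hm => by
      have h : m.degree < k := hm
      exact h.le)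

theorem exists_totalDegree_le_card_eval_eq (S : Finset (σ → K)) (y : S → K) :
    ∃ p : MvPolynomial σ K, p.totalDegree ≤ S.card ∧ ∀ x : S, eval x.1 p = y x := by
  classical
  have h : ∀ a b : σ → K, ∃ l : MvPolynomial σ K, l.totalDegree ≤ 1 ∧
      (a ≠ b → eval a l ≠ 0) ∧ eval b l = 0 := by
    intro a b
    by_cases hab : a = b
    · exact ⟨0, by simp [hab]⟩
    · obtain ⟨i, hi⟩ := Function.ne_iff.1 hab
      refine ⟨X i - C (b i), ?_, fun _ => ?_, by simp⟩
      · refine (totalDegree_sub_C_le _ _).trans (by simp)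
      · simpa [sub_eq_zero] using hi
  choose l hl hl' hl'' using h
  let q : S → MvPolynomial σ K := fun a => ∏ b ∈ S.erase a.1, l a.1 b
  have hq0 : ∀ a : S, eval a.1 (q a) ≠ 0 := by
    intro a
    simp only [q, eval_prod]
    exact Finset.prod_ne_zero_iff.2 fun b hb => hl' _ _ (Finset.ne_of_mem_erase hb).symm
  have hq : ∀ a x : S, a ≠ x → eval x.1 (q a) = 0 := by
    intro a x hax
    simp only [q, eval_prod]
    exact Finset.prod_eq_zero (i := x.1)
      (Finset.mem_erase.2 ⟨fun h => hax (Subtype.ext h.symm), x.2⟩) (hl'' _ _)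
  refine ⟨∑ a, C (y a / eval a.1 (q a)) * q a, ?_, fun x => ?_⟩
  · refine totalDegree_finsetSum_le fun a _ => (totalDegree_mul _ _).trans ?_
    rw [totalDegree_C, zero_add]
    refine (totalDegree_finsetProd _ _).trans
      ((Finset.sum_le_card_nsmul _ _ 1 fun b _ => hl _ _).trans ?_)
    simp
  · rw [map_sum, Finset.sum_eq_single x]
    · simp [hq0]
    · intro a _ hax
      simp [hq a x hax]
    · simp

/-- A weak Bézout bound for perturbations of the system `X i ^ e i + c i = 0`. -/
theorem finite_setOf_prod_lt_card_zeros [Fintype σ] {e : σ → ℕ} (he : ∀ i, 0 < e i) (c : σ → K)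
    (h : σ → MvPolynomial σ K) (hdeg : ∀ i, (h i).totalDegree ≤ e i) :
    {s : K | ∃ S : Finset (σ → K), ∏ i, e i < S.card ∧
      ∀ x ∈ S, ∀ i, x i ^ e i + c i + s * eval x (h i) = 0}.Finite := by
  classical
  set k := ∏ i, e i + 2 with hk
  let W := restrictSupport K {m : σ →₀ ℕ | m.degree < k}
  let N := reduceLeading e fun i => (C (c i) : MvPolynomial σ K)
  have hN : ∀ p ∈ W, ((LinearMap.id : MvPolynomial σ K →ₗ[K] MvPolynomial σ K) + N) p ∈ W :=
    fun p hp => add_mem hp (reduceLeading_mem_restrictSupport (e := e) (g := fun i => C (c i)) (r := 0)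
      (by simp) hp)
  have hH : ∀ p ∈ W, reduceLeading e h p ∈ W := fun p hp =>
    reduceLeading_mem_restrictSupport (r := 0) hdeg hp
  refine (LinearMap.finite_setOf_not_surjective_add_smul ((LinearMap.id + N).restrict hN)
    ((reduceLeading e h).restrict hH) ?_).subset ?_
  · rintro ⟨p, hp⟩
    obtain ⟨q, hq, hqp⟩ := exists_add_reduceLeading_eq
      (g := fun i => (C (c i) : MvPolynomial σ K)) (by simpa using he) k hp
    exact ⟨⟨q, hq⟩, Subtype.ext hqp⟩
  rintro s ⟨S₀, hcard₀, hS₀⟩ hsurj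
  obtain ⟨S, hSS, hcard⟩ := Finset.exists_subset_card_eq (n := ∏ i, e i + 1) hcard₀
  let E : MvPolynomial σ K →ₗ[K] (S → K) := LinearMap.pi fun x => (aeval x.1).toLinearMap
  let F : (∀ i, Fin (e i)) → (S → K) := fun a x => ∏ i, x.1 i ^ (a i : ℕ)
  have hspan : ∀ p, E (p + N p + s • reduceLeading e h p) ∈ Submodule.span K (Set.range F) := by
    intro p
    have hp : p ∈ Submodule.span K (Set.range (basisMonomials σ K)) := by
      rw [(basisMonomials σ K).span_eq]; trivial
    induction hp using Submodule.span_induction with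
    | zero => simp
    | add x y _ _ hx hy =>
      convert! add_mem hx hy using 1
      simp only [map_add, smul_add]
      abel
    | smul a x _ hx =>
      convert! Submodule.smul_mem _ a hx using 1
      simp only [map_add, map_smul, smul_add]
      rw [smul_comm]
    | mem x hx =>
      obtain ⟨m, rfl⟩ := hx
      rw [coe_basisMonomials]
      by_cases hm : ∃ i, e i ≤ m i
      · obtain ⟨i, hi, hL⟩ := reduceLeading_monomial_of_exists (K := K) hm
        suffices hz :
            E (monomial m 1 + N (monomial m 1) + s • reduceLeading e h (monomial m 1)) = 0 by
          rw [hz]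
          exact zero_mem _
        funext x
        have h1 : m = (m - Finsupp.single i (e i)) + Finsupp.single i (e i) := by
          rw [tsub_add_cancel_of_le]
          simpa using hi
        have h2 : (monomial m (1 : K)) = monomial (m - Finsupp.single i (e i)) 1 * X i ^ e i := by
          conv_lhs => rw [h1]
          rw [X_pow_eq_monomial, monomial_mul, one_mul]
        have h3 : monomial m 1 + N (monomial m 1) + s • reduceLeading e h (monomial m 1) =
            monomial (m - Finsupp.single i (e i)) 1 * (X i ^ e i + C (c i) + C s * h i) := by
          rw [hL h, show N (monomial m 1) = _ from hL _, h2, smul_eq_C_mul]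
          ring
        change aeval x.1 _ = 0
        rw [h3, map_mul]
        have h4 := hS₀ x.1 (hSS x.2) i
        simp [aeval_eq_eval, h4]
      · push Not at hm
        have h0 : ¬ ∃ i, e i ≤ m i := by push Not; exact hm
        rw [show N (monomial m 1) = 0 from reduceLeading_monomial_of_not_exists h0 _,
          reduceLeading_monomial_of_not_exists h0, smul_zero, add_zero, add_zero]
        refine Submodule.subset_span ⟨fun i => ⟨m i, hm i⟩, ?_⟩
        funext x
        change _ = aeval x.1 _
        simp [F, aeval_eq_eval, eval_monomial, Finsupp.prod_fintype]
  have htop : Submodule.span K (Set.range F) = ⊤ := by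
    rw [eq_top_iff]
    rintro y -
    obtain ⟨p, hp, hpy⟩ := exists_totalDegree_le_card_eval_eq S y
    obtain ⟨⟨q, hq⟩, hqp⟩ := hsurj
      ⟨p, mem_restrictSupport_degree_lt_of_totalDegree_lt (by omega)⟩
    have h1 : q + N q + s • reduceLeading e h q = p := congrArg Subtype.val hqp
    have h2 := hspan q
    rw [h1] at h2
    convert! h2 using 1
    funext x
    change _ = aeval x.1 p
    exact (hpy x).symm
  have h1 := finrank_range_le_card (R := K) F
  rw [Set.finrank, htop, finrank_top, Module.finrank_fintype_fun_eq_card] at h1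
  simp [hcard] at h1

theorem totalDegree_pderiv_le (i : σ) (p : MvPolynomial σ K) :
    (pderiv i p).totalDegree ≤ p.totalDegree - 1 := by
  conv_lhs => rw [p.as_sum, map_sum]
  refine totalDegree_finsetSum_le fun m hm => ?_
  rw [pderiv_monomial]
  by_cases hmi : m i = 0
  · simp [hmi]
  · refine (totalDegree_monomial_le _ _).trans ?_
    have h1 : m = (m - Finsupp.single i 1) + Finsupp.single i 1 := by
      rw [tsub_add_cancel_of_le]
      simpa using Nat.one_le_iff_ne_zero.2 hmi
    have h2 : m.degree = (m - Finsupp.single i 1).degree + 1 := by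
      conv_lhs => rw [h1]
      simp
    have h3 : m.degree ≤ p.totalDegree := le_totalDegree hm
    change (m - Finsupp.single i 1).degree ≤ _
    omega

theorem hasDerivAt_eval_add_smul [Fintype σ] (p : MvPolynomial σ ℝ) (q v : σ → ℝ) :
    HasDerivAt (fun t : ℝ => eval (q + t • v) p) (∑ j, v j * eval q (pderiv j p)) 0 := by
  classical
  induction p using MvPolynomial.induction_on with
  | C a => simpa using hasDerivAt_const (0 : ℝ) a
  | add p₁ p₂ h₁ h₂ =>
    simp only [map_add, mul_add, Finset.sum_add_distrib]
    exact h₁.add h₂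
  | mul_X p i h =>
    have h1 : HasDerivAt (fun t : ℝ => q i + t * v i) (v i) 0 := by
      simpa using ((hasDerivAt_id (0 : ℝ)).mul_const (v i)).const_add (q i)
    have h2 := h.mul h1
    simp only [Derivation.leibniz, pderiv_X, smul_eq_mul, map_add, map_mul, eval_X]
    convert! h2 using 1
    simp only [zero_smul, add_zero, zero_mul, Pi.single_apply, mul_add, Finset.sum_add_distrib,
      Finset.sum_mul]
    rw [add_comm]
    congr 1
    · exact Finset.sum_congr rfl fun j _ => by ring
    · simp [apply_ite, mul_comm]

end MvPolynomial
theorem MvPolynomial.eval_eq_zero_and_pderiv_eq_zero_of_forall_le {σ : Type*} [Fintype σ]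
    {Q : MvPolynomial σ ℝ} {U : Set (σ → ℝ)} (hU : IsOpen U) {q : σ → ℝ} (hqU : q ∈ U)
    (hq : eval q Q ≤ 0) {i₀ : σ} {a : ℝ} (ha : a ≠ 0)
    (hmax : ∀ x ∈ U, eval x Q ≤ 0 → a * x i₀ ≤ a * q i₀) :
    eval q Q = 0 ∧ ∀ j ≠ i₀, eval q (pderiv j Q) = 0 := by
  classical
  have key : ∀ v : σ → ℝ, 0 < a * v i₀ →
      (∀ᶠ t in nhdsWithin (0 : ℝ) (Set.Ioi 0), eval (q + t • v) Q < 0) → False := by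
    intro v hv hev
    have hcont : Continuous fun t : ℝ => q + t • v := by fun_prop
    have h1 : ∀ᶠ t in nhdsWithin (0 : ℝ) (Set.Ioi 0), q + t • v ∈ U :=
      (hcont.tendsto' 0 q (by simp)).mono_left nhdsWithin_le_nhds (hU.mem_nhds hqU)
    obtain ⟨t, ⟨ht1, ht2⟩, ht3⟩ := ((hev.and h1).and self_mem_nhdsWithin).exists
    have h2 := hmax _ ht2 ht1.le
    have h3 : 0 < t * (a * v i₀) := mul_pos ht3 hv
    simp only [Pi.add_apply, Pi.smul_apply, smul_eq_mul] at h2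
    linarith
  have hq0 : eval q Q = 0 := by
    by_contra hne
    have hlt : eval q Q < 0 := lt_of_le_of_ne hq hne
    refine key (Pi.single i₀ a) (by simpa using mul_self_pos.2 ha) ?_
    have hcont : Continuous fun t : ℝ => eval (q + t • Pi.single i₀ a) Q :=
      (continuous_eval Q).comp (by fun_prop)
    exact (hcont.tendsto' 0 (eval q Q) (by simp)).mono_left nhdsWithin_le_nhds
      (Iio_mem_nhds hlt)
  refine ⟨hq0, fun j hj => ?_⟩
  by_contra hD
  set D := eval q (pderiv j Q) with hDdef
  set T := a * eval q (pderiv i₀ Q) with hT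
  set τ := D ^ 2 / (2 * (|T| + 1)) with hτ
  have hD2 : 0 < D ^ 2 := by positivity
  have hτ0 : 0 < τ := by positivity
  have hτT : τ * T < D ^ 2 := by
    have h1 : τ * (2 * (|T| + 1)) = D ^ 2 := by
      rw [hτ]
      field_simp
    have h2 := le_abs_self T
    nlinarith [abs_nonneg T]
  let v : σ → ℝ := Pi.single i₀ (τ * a) + Pi.single j (-D)
  have hderiv := hasDerivAt_eval_add_smul Q q v
  have hsum : ∑ k, v k * eval q (pderiv k Q) = τ * T - D ^ 2 := by
    simp only [v, Pi.add_apply, add_mul, Finset.sum_add_distrib, Pi.single_apply, ite_mul, zero_mul,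
      Finset.sum_ite_eq', Finset.mem_univ, if_true]
    rw [hT, ← hDdef]
    ring
  refine key v ?_ ?_
  · simp only [v, Pi.add_apply, Pi.single_eq_same, Pi.single_eq_of_ne hj.symm, add_zero]
    have := mul_self_pos.2 ha
    nlinarith
  · rw [hsum, hasDerivAt_iff_tendsto_slope] at hderiv
    have hneg : ∀ᶠ t in nhdsWithin (0 : ℝ) {0}ᶜ, slope (fun t : ℝ => eval (q + t • v) Q) 0 t < 0 :=
      hderiv (Iio_mem_nhds (by linarith))
    have hneg' := hneg.filter_mono (nhdsWithin_mono 0 (fun t (ht : 0 < t) => ht.ne'))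
    filter_upwards [hneg', self_mem_nhdsWithin] with t ht ht0
    have ht0' : (0 : ℝ) < t := ht0
    simp only [slope_def_field, zero_smul, add_zero, hq0, sub_zero] at ht
    rw [div_lt_iff₀ ht0', zero_mul] at ht
    exact ht

theorem ContinuousMap.exists_eq_of_injective_connectedComponents {X ι Y : Type*}
    [TopologicalSpace X] [T2Space X] [CompactSpace X] [TopologicalSpace Y] [Finite ι] [Nonempty ι]
    (p : ι → X) (hp : Function.Injective fun i => (p i : ConnectedComponents X)) (y : ι → Y) :
    ∃ g : C(X, Y), (∀ i, g (p i) = y i) ∧ ∀ x, ∃ i, g x = y i := by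
  have hsep : ∀ i j, ∃ C : Set X, IsClopen C ∧ (i ≠ j → p i ∈ C ∧ p j ∉ C) := by
    intro i j
    by_cases hij : i = j
    · exact ⟨∅, isClopen_empty, fun h => absurd hij h⟩
    · have h1 : p j ∉ connectedComponent (p i) := fun h =>
        hij (hp (ConnectedComponents.coe_eq_coe.2 (connectedComponent_eq h)))
      rw [connectedComponent_eq_iInter_isClopen, Set.mem_iInter] at h1
      push Not at h1
      obtain ⟨⟨C, hC, hiC⟩, hj⟩ := h1
      exact ⟨C, hC, fun _ => ⟨hiC, hj⟩⟩
  choose C hC hCmem using hsep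
  let code : X → ι → ι → Bool := fun x i j => (C i j).boolIndicator x
  have hcode : Continuous code := continuous_pi fun i => continuous_pi fun j =>
    (continuous_boolIndicator_iff_isClopen _).2 (hC i j)
  have hinj : Function.Injective (code ∘ p) := by
    intro i j hij
    by_contra hne
    have h1 : (C i j).boolIndicator (p i) = (C i j).boolIndicator (p j) :=
      congrFun (congrFun hij i) j
    obtain ⟨h2, h3⟩ := hCmem i j hne
    rw [(Set.mem_iff_boolIndicator _ _).1 h2, (Set.notMem_iff_boolIndicator _ _).1 h3] at h1
    exact Bool.noConfusion h1
  refine ⟨⟨fun x => y (Function.invFun (code ∘ p) (code x)),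
    (continuous_of_discreteTopology (f := fun b => y (Function.invFun (code ∘ p) b))).comp hcode⟩,
    fun i => ?_, fun x => ⟨_, rfl⟩⟩
  exact congrArg y (Function.leftInverse_invFun hinj i)

theorem isCompact_setOf_sum_pow_le {σ : Type*} [Fintype σ] {d : ℕ} (hd : 1 ≤ d) (R : ℝ) :
    IsCompact {x : σ → ℝ | ∑ i, x i ^ (2 * d) ≤ R} := by
  refine IsCompact.of_isClosed_subset (isCompact_Icc (a := fun _ => -(|R| + 1))
    (b := fun _ => |R| + 1)) (isClosed_le (by fun_prop) continuous_const) fun x hx => ?_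
  have hxi : ∀ i, |x i| ≤ |R| + 1 := by
    intro i
    by_contra! hlt
    have h1 : x i ^ (2 * d) ≤ ∑ i, x i ^ (2 * d) :=
      Finset.single_le_sum (f := fun i => x i ^ (2 * d))
        (fun j _ => (even_two_mul d).pow_nonneg _) (Finset.mem_univ i)
    have h2 : |x i| ≤ |x i| ^ (2 * d) :=
      le_self_pow₀ (by linarith [abs_nonneg R]) (by omega)
    rw [(even_two_mul d).pow_abs] at h2
    have h3 : ∑ i, x i ^ (2 * d) ≤ R := hx
    linarith [le_abs_self R]
  exact ⟨fun i => (abs_le.1 (hxi i)).1, fun i => (abs_le.1 (hxi i)).2⟩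

theorem MvPolynomial.card_le_of_injective_connectedComponents {n d m : ℕ} (hd : 1 ≤ d)
    (F : MvPolynomial (Fin (n + 1)) ℝ) (hF : F.totalDegree ≤ 2 * d) (hF0 : ∀ x, 0 ≤ eval x F)
    (p : Fin m → {x : Fin (n + 1) → ℝ | eval x F = 0})
    (hp : Function.Injective fun i =>
      (p i : ConnectedComponents {x : Fin (n + 1) → ℝ | eval x F = 0})) :
    m ≤ d * (2 * d - 1) ^ n := by
  rcases Nat.eq_zero_or_pos m with rfl | hm
  · exact Nat.zero_le _
  have : Nonempty (Fin m) := ⟨⟨0, hm⟩⟩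
  let G : (Fin (n + 1) → ℝ) → ℝ := fun x => ∑ i, x i ^ (2 * d)
  have hG : Continuous G := by fun_prop
  have hG0 : ∀ x, 0 ≤ G x := fun x => Finset.sum_nonneg fun i _ => (even_two_mul d).pow_nonneg _
  have hFc : Continuous fun x => eval x F := continuous_eval F
  obtain ⟨R, hR⟩ : ∃ R : ℝ, ∀ i, G (p i).1 < R := by
    refine ⟨∑ i, G (p i).1 + 1, fun i => ?_⟩
    have := Finset.single_le_sum (f := fun i => G (p i).1) (fun i _ => hG0 _) (Finset.mem_univ i)
    exact lt_of_le_of_lt this (lt_add_one _)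
  have hB : IsCompact {x | G x ≤ R} := isCompact_setOf_sum_pow_le hd R
  let K : Set (Fin (n + 1) → ℝ) := {x | eval x F = 0 ∧ G x ≤ R}
  have hK : IsCompact K := hB.inter_left (isClosed_eq hFc continuous_const)
  have hKspace : CompactSpace K := isCompact_iff_compactSpace.1 hK
  -- a continuous function on the whole space that separates the points `p i` inside `K`
  obtain ⟨Γ, hΓp, hΓK⟩ : ∃ Γ : C(Fin (n + 1) → ℝ, ℝ), (∀ i, Γ (p i).1 = (i : ℕ)) ∧
      ∀ x ∈ K, ∃ i : Fin m, Γ x = (i : ℕ) := by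
    let p' : Fin m → K := fun i => ⟨(p i).1, (p i).2, (hR i).le⟩
    have hp' : Function.Injective fun i => (p' i : ConnectedComponents K) := by
      intro i j hij
      let incl : K → {x : Fin (n + 1) → ℝ | eval x F = 0} := fun x => ⟨x.1, x.2.1⟩
      have hincl : Continuous incl := by fun_prop
      exact hp (congrArg hincl.connectedComponentsMap hij)
    obtain ⟨g, hg, hg'⟩ := ContinuousMap.exists_eq_of_injective_connectedComponents p' hp'
      fun i => ((i : ℕ) : ℝ)
    obtain ⟨Γ, hΓ⟩ := g.exists_restrict_eq hK.isClosed
    have hΓ' : ∀ x : K, Γ x.1 = g x := fun x => by rw [← hΓ]; rfl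
    exact ⟨Γ, fun i => (hΓ' (p' i)).trans (hg i), fun x hx => by
      rw [hΓ' ⟨x, hx⟩]
      exact hg' ⟨x, hx⟩⟩
  let O : Set (Fin (n + 1) → ℝ) := ⋃ i : Fin m, {x | |Γ x - (i : ℕ)| < 1 / 3}
  have hUopen : ∀ i : Fin m, IsOpen {x | |Γ x - (i : ℕ)| < 1 / 3} := fun i =>
    isOpen_lt (by fun_prop) continuous_const
  have hO : IsOpen O := isOpen_iUnion hUopen
  have hKO : K ⊆ O := fun x hx => by
    obtain ⟨i, hi⟩ := hΓK x hx
    exact Set.mem_iUnion.2 ⟨i, by simp [hi]⟩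
  obtain ⟨s₀, hs₀, hsO⟩ : ∃ s₀ : ℝ, 0 ≤ s₀ ∧
      ∀ s ≥ s₀, ∀ x, s * eval x F + G x ≤ R → x ∈ O := by
    rcases ({x | G x ≤ R} \ O).eq_empty_or_nonempty with hemp | hne
    · refine ⟨0, le_rfl, fun s hs x hx => ?_⟩
      by_contra hxO
      have h1 : G x ≤ R := by nlinarith [mul_nonneg hs (hF0 x)]
      exact (Set.eq_empty_iff_forall_notMem.1 hemp) x ⟨h1, hxO⟩
    · obtain ⟨x₀, hx₀, hmin⟩ := (hB.diff hO).exists_isMinOn hne hFc.continuousOn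
      have hpos : 0 < eval x₀ F := lt_of_le_of_ne (hF0 x₀) fun h =>
        hx₀.2 (hKO ⟨h.symm, hx₀.1⟩)
      refine ⟨(|R| + 1) / eval x₀ F, by positivity, fun s hs x hx => ?_⟩
      by_contra hxO
      have hs0 : 0 ≤ s := le_trans (by positivity) hs
      have h1 : G x ≤ R := by linarith [mul_nonneg hs0 (hF0 x)]
      have h2 : eval x₀ F ≤ eval x F := hmin ⟨h1, hxO⟩
      have h3 : |R| + 1 ≤ s * eval x₀ F := (div_le_iff₀ hpos).1 hs
      have h4 := mul_le_mul_of_nonneg_left h2 hs0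
      linarith [le_abs_self R, hG0 x]
  let e : Fin (n + 1) → ℕ := Fin.cons (2 * d) fun _ => 2 * d - 1
  let c : Fin (n + 1) → ℝ := Fin.cons (-R) fun _ => 0
  let h : Fin (n + 1) → MvPolynomial (Fin (n + 1)) ℝ :=
    Fin.cons (F - ∑ j : Fin n, C (2 * d : ℝ)⁻¹ * (X j.succ * pderiv j.succ F))
      fun j => C (2 * d : ℝ)⁻¹ * pderiv j.succ F
  have hpd : ∀ j, (pderiv j F).totalDegree ≤ 2 * d - 1 := fun j =>
    (totalDegree_pderiv_le j F).trans (by omega)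
  have hC : ∀ q : MvPolynomial (Fin (n + 1)) ℝ,
      (C (2 * d : ℝ)⁻¹ * q).totalDegree ≤ q.totalDegree := fun q =>
    (totalDegree_mul _ _).trans (by rw [totalDegree_C, zero_add])
  have hdeg : ∀ i, (h i).totalDegree ≤ e i := by
    intro i
    induction i using Fin.cases with
    | zero =>
      refine (totalDegree_sub _ _).trans (max_le hF (totalDegree_finsetSum_le fun j _ => ?_))
      refine (hC _).trans ((totalDegree_mul _ _).trans ?_)
      have := hpd j.succ
      rw [totalDegree_X]
      change _ ≤ 2 * d
      omega
    | succ j => exact (hC _).trans (hpd _)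
  have he : ∀ i, 0 < e i := by
    intro i
    induction i using Fin.cases with
    | zero => change 0 < 2 * d; omega
    | succ j => change 0 < 2 * d - 1; omega
  obtain ⟨s, hs, hsbad⟩ := ((Set.Ici_infinite s₀).sdiff
    (finite_setOf_prod_lt_card_zeros he c h hdeg)).nonempty
  replace hs : s₀ ≤ s := hs
  let Q : MvPolynomial (Fin (n + 1)) ℝ := C s * F + ∑ i, X i ^ (2 * d) - C R
  have hQ : ∀ x, eval x Q = s * eval x F + G x - R := fun x => by simp [Q, G]
  have hQpd : ∀ x j, eval x (pderiv j Q) =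
      s * eval x (pderiv j F) + 2 * d * x j ^ (2 * d - 1) := fun x j => by
    simp [Q, Derivation.leibniz, Pi.single_apply, apply_ite]
  have hd0 : (d : ℝ) ≠ 0 := by positivity
  have hsys : ∀ x, eval x Q = 0 → (∀ j ≠ 0, eval x (pderiv j Q) = 0) →
      ∀ i, x i ^ e i + c i + s * eval x (h i) = 0 := by
    intro x hx hxj i
    have hj : ∀ j : Fin n, x j.succ ^ (2 * d - 1) +
        s * ((2 * d : ℝ)⁻¹ * eval x (pderiv j.succ F)) = 0 := by
      intro j
      have h1 := hxj j.succ (Fin.succ_ne_zero j)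
      rw [hQpd] at h1
      field_simp
      linarith
    induction i using Fin.cases with
    | zero =>
      have h2 : ∑ j : Fin n, x j.succ ^ (2 * d) =
          -(s * ∑ j : Fin n, (2 * d : ℝ)⁻¹ * (x j.succ * eval x (pderiv j.succ F))) := by
        rw [Finset.mul_sum, ← Finset.sum_neg_distrib]
        refine Finset.sum_congr rfl fun j _ => ?_
        have h3 : x j.succ ^ (2 * d) = x j.succ * x j.succ ^ (2 * d - 1) := by
          rw [← pow_succ']
          congr 1
          omega
        rw [h3]
        linear_combination x j.succ * hj j
      rw [hQ] at hx
      simp only [G, Fin.sum_univ_succ] at hx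
      simp only [e, c, h, Fin.cons_zero, map_sub, map_sum, map_mul, eval_C, eval_X]
      linear_combination hx - h2
    | succ j =>
      simp only [e, c, h, Fin.cons_succ, map_mul, eval_C, add_zero]
      exact hj j
  have hext : ∀ (i : Fin m) (a : ℝ), ∃ q : Fin (n + 1) → ℝ, |Γ q - (i : ℕ)| < 1 / 3 ∧
      eval q Q ≤ 0 ∧ ∀ x, |Γ x - (i : ℕ)| < 1 / 3 → eval x Q ≤ 0 → a * x 0 ≤ a * q 0 := by
    intro i a
    have hcomp : IsCompact {x | |Γ x - (i : ℕ)| ≤ 1 / 3 ∧ eval x Q ≤ 0} := by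
      refine hB.of_isClosed_subset (IsClosed.inter
        (isClosed_le (f := fun x => |Γ x - (i : ℕ)|) (by fun_prop) continuous_const)
        (isClosed_le (continuous_eval Q) continuous_const)) fun x hx => ?_
      have h1 := hx.2
      rw [hQ] at h1
      have h2 := mul_nonneg (hs₀.trans hs) (hF0 x)
      change G x ≤ R
      linarith
    obtain ⟨q, hq, hqmax⟩ := hcomp.exists_isMaxOn ⟨(p i).1, by
      have h1 : eval (p i).1 F = 0 := (p i).2
      have h2 := hR i
      refine ⟨by simp [hΓp], ?_⟩
      rw [hQ, h1]
      linarith⟩ (f := fun x => a * x 0) (by fun_prop)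
    refine ⟨q, ?_, hq.2, fun x hx hxQ => hqmax ⟨hx.le, hxQ⟩⟩
    have hqO : q ∈ O := hsO s hs q (by have := hq.2; rw [hQ] at this; linarith)
    obtain ⟨j, hj⟩ := Set.mem_iUnion.1 hqO
    replace hj : |Γ q - (j : ℕ)| < 1 / 3 := hj
    have hij : i = j := by
      have h1 := hq.1
      have h2 : |((i : ℕ) : ℝ) - (j : ℕ)| < 1 := by
        rw [abs_lt] at hj ⊢
        rw [abs_le] at h1
        constructor <;> linarith
      have h3 : |((i : ℕ) : ℤ) - (j : ℕ)| < 1 := by exact_mod_cast h2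
      rw [Int.abs_lt_one_iff] at h3
      exact Fin.ext (by omega)
    rwa [hij]
  choose z hzU hzQ hzmax using hext
  let a : Bool → ℝ := fun b => if b then 1 else -1
  have ha : ∀ b, a b ≠ 0 := fun b => by cases b <;> simp [a]
  let w : Fin m × Bool → (Fin (n + 1) → ℝ) := fun k => z k.1 (a k.2)
  have hw : Function.Injective w := by
    have hne : ∀ i, z i 1 ≠ z i (-1) := by
      intro i heq
      have hpi : (p i).1 0 = z i 1 0 := by
        have h1 : eval (p i).1 F = 0 := (p i).2
        have h2 : eval (p i).1 Q ≤ 0 := by rw [hQ, h1]; linarith [hR i]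
        have h3 := hzmax i 1 (p i).1 (by simp [hΓp]) h2
        have h4 := hzmax i (-1) (p i).1 (by simp [hΓp]) h2
        rw [← heq] at h4
        linarith
      have h1 : eval (p i).1 F = 0 := (p i).2
      have h2 : eval (p i).1 Q < 0 := by rw [hQ, h1]; linarith [hR i]
      refine h2.ne (eval_eq_zero_and_pderiv_eq_zero_of_forall_le (hUopen i) (i₀ := 0)
        (by simp [hΓp]) h2.le one_ne_zero fun x hx hxQ => ?_).1
      rw [hpi]
      exact hzmax i 1 x hx hxQ
    rintro ⟨i, b⟩ ⟨j, b'⟩ hij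
    have h0 : z i (a b) = z j (a b') := hij
    have hij' : i = j := by
      have h1 := hzU i (a b)
      have h2 := hzU j (a b')
      rw [h0] at h1
      have h3 : |((i : ℕ) : ℝ) - (j : ℕ)| < 1 := by
        rw [abs_lt] at *
        constructor <;> linarith
      have h4 : |((i : ℕ) : ℤ) - (j : ℕ)| < 1 := by exact_mod_cast h3
      rw [Int.abs_lt_one_iff] at h4
      exact Fin.ext (by omega)
    subst hij'
    cases b <;> cases b' <;> simp_all [a]
    · exact absurd h0.symm (hne i)
  have hcard : ¬ ∏ i, e i < (Finset.univ.image w).card := fun hlt => by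
    refine hsbad ⟨Finset.univ.image w, hlt, fun x hx => ?_⟩
    obtain ⟨⟨i, b⟩, -, rfl⟩ := Finset.mem_image.1 hx
    obtain ⟨h1, h2⟩ := eval_eq_zero_and_pderiv_eq_zero_of_forall_le (hUopen i) (i₀ := 0)
      (hzU i (a b)) (hzQ i (a b)) (ha b) (hzmax i (a b))
    exact hsys _ h1 h2
  rw [Finset.card_image_of_injective _ hw, Fin.prod_univ_succ] at hcard
  simp only [e, Fin.cons_zero, Fin.cons_succ, Finset.prod_const, Finset.card_univ,
    Fintype.card_prod, Fintype.card_fin, Fintype.card_bool, mul_assoc] at hcard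
  omega

/-- **Oleinik–Petrovski–Thom–Milnor.** If `V ⊆ ℝⁿ` is defined by polynomial equations
`f 1 = ⋯ = f p = 0` where each `f i` has total degree at most `d`, `d ≥ 1`, then `V`
has at most `d·(2d - 1)^{n-1}` connected components. -/
theorem connected_components_algebraic_set_le
    (n p d : ℕ) (hd : 1 ≤ d)
    (f : Fin p → MvPolynomial (Fin n) ℝ)
    (hdeg : ∀ i, (f i).totalDegree ≤ d) :
    Finite (ConnectedComponents {x : Fin n → ℝ | ∀ i, eval x (f i) = 0}) ∧
      Nat.card (ConnectedComponents {x : Fin n → ℝ | ∀ i, eval x (f i) = 0}) ≤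
        d * (2 * d - 1) ^ (n - 1) := by
  rcases n with _ | n
  · have : Subsingleton (ConnectedComponents {x : Fin 0 → ℝ | ∀ i, eval x (f i) = 0}) :=
      ConnectedComponents.surjective_coe.subsingleton
    refine ⟨inferInstance, (Finite.card_le_one_iff_subsingleton.2 this).trans ?_⟩
    simpa using hd
  let F : MvPolynomial (Fin (n + 1)) ℝ := ∑ i, f i ^ 2
  have hFx : ∀ x, eval x F = ∑ i, eval x (f i) ^ 2 := fun x => by simp [F]
  have hV : {x : Fin (n + 1) → ℝ | ∀ i, eval x (f i) = 0} = {x | eval x F = 0} := by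
    ext x
    simp [hFx, Finset.sum_eq_zero_iff_of_nonneg, sq_nonneg]
  have hF : F.totalDegree ≤ 2 * d := totalDegree_finsetSum_le fun i _ =>
    (totalDegree_pow _ _).trans (Nat.mul_le_mul_left 2 (hdeg i))
  have hF0 : ∀ x, 0 ≤ eval x F := fun x => by
    rw [hFx]
    exact Finset.sum_nonneg fun i _ => sq_nonneg _
  rw [hV]
  have hbound : ∀ {m : ℕ} (φ : Fin m → ConnectedComponents {x | eval x F = 0}),
      Function.Injective φ → m ≤ d * (2 * d - 1) ^ n := by
    intro m φ hφ
    choose p hp using fun i => ConnectedComponents.surjective_coe (φ i)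
    exact MvPolynomial.card_le_of_injective_connectedComponents hd F hF hF0 p
      (by simpa only [hp] using hφ)
  have hfin : Finite (ConnectedComponents {x | eval x F = 0}) := by
    by_contra hinf
    rw [not_finite_iff_infinite] at hinf
    have := hbound (fun i : Fin (d * (2 * d - 1) ^ n + 1) => Infinite.natEmbedding _ i)
      fun i j hij => Fin.ext ((Infinite.natEmbedding _).injective hij)
    omega
  exact ⟨hfin, hbound (Finite.equivFin _).symm (Finite.equivFin _).symm.injective⟩
end
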